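/- Let (Ω, 𝓕, P) be a probability space with a filtration (𝓕_t)_{t∈ℕ}, let d, N ∈ ℕ with d ≥ 1, N ≥ 1, let λ > 0, B > 0, δ ∈ (0,1), and w ∈ ℝ^d. For t = 1, …, N, let φ_t : Ω → ℝ^d be 𝓕_t-measurable with ‖φ_t‖_2 ≤ 1 almost surely, and let y_t : Ω → ℝ be 𝓕_{t+1}-measurable with 0 ≤ y_t ≤ B almost surely and E[y_t | 𝓕_t] = φ_tᵀw almost surely. Define Σ̂_t := λI_d + Σ_{s=1}^{t} φ_sφ_sᵀ, Ŵ_t := Σ̂_t^{-1} Σ_{s=1}^{t} φ_s y_s, and Θ_t := (Ŵ_t − w)ᵀ Σ̂_t (Ŵ_t − w). Then with probability at least 1 − δ, simultaneously for all n = 1, …, N: √(Θ_n) ≤ √(2λ)‖w‖_2 + 2√2 · B · √( d · ln(1 + n/(λd)) · ln(2n²/δ) ) + (4/3) · B · ln(2n²/δ). -/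

import Mathlib

open Matrix Finset MeasureTheory

section LinearAlgebra

variable {ι : Type*} [Fintype ι]

theorem posSemidef_vecMulVec_self (x : ι → ℝ) : (vecMulVec x x).PosSemidef := by
  simpa using posSemidef_vecMulVec_self_star x

variable [DecidableEq ι]

theorem Matrix.PosDef.mulVec_inv_mulVec {V : Matrix ι ι ℝ} (hV : V.PosDef) (b : ι → ℝ) :
    V *ᵥ (V⁻¹ *ᵥ b) = b := by
  rw [mulVec_mulVec, mul_nonsing_inv _ ((isUnit_iff_isUnit_det V).1 hV.isUnit), one_mulVec]

theorem Matrix.PosDef.inv_mulVec_mulVec {V : Matrix ι ι ℝ} (hV : V.PosDef) (b : ι → ℝ) :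
    V⁻¹ *ᵥ (V *ᵥ b) = b := by
  rw [mulVec_mulVec, nonsing_inv_mul _ ((isUnit_iff_isUnit_det V).1 hV.isUnit), one_mulVec]

theorem Matrix.PosDef.dotProduct_inv_mulVec_comm {V : Matrix ι ι ℝ} (hV : V.PosDef)
    (a b : ι → ℝ) : a ⬝ᵥ V⁻¹ *ᵥ b = b ⬝ᵥ V⁻¹ *ᵥ a := by
  have h : (V⁻¹)ᵀ = V⁻¹ := by simpa using hV.inv.isHermitian.eq
  rw [dotProduct_mulVec, ← mulVec_transpose, h, dotProduct_comm]

theorem Matrix.PosDef.dotProduct_inv_mulVec_nonneg {V : Matrix ι ι ℝ} (hV : V.PosDef)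
    (a : ι → ℝ) : 0 ≤ a ⬝ᵥ V⁻¹ *ᵥ a := by
  simpa using hV.inv.posSemidef.dotProduct_mulVec_nonneg a

/-- The inverse quadratic form after a rank-one update of both the matrix and the vector. -/
theorem Matrix.PosDef.inv_form_add_vecMulVec {V : Matrix ι ι ℝ} (hV : V.PosDef)
    (S x : ι → ℝ) (e : ℝ) :
    (S + e • x) ⬝ᵥ (V + vecMulVec x x)⁻¹ *ᵥ (S + e • x) =
      S ⬝ᵥ V⁻¹ *ᵥ S + (2 * e * (x ⬝ᵥ V⁻¹ *ᵥ S) + e ^ 2 * (x ⬝ᵥ V⁻¹ *ᵥ x)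
        - (x ⬝ᵥ V⁻¹ *ᵥ S) ^ 2) / (1 + x ⬝ᵥ V⁻¹ *ᵥ x) := by
  have hV' : (V + vecMulVec x x).PosDef := hV.add_posSemidef (posSemidef_vecMulVec_self x)
  have hu := hV.dotProduct_inv_mulVec_nonneg x
  have hsymm := hV.dotProduct_inv_mulVec_comm S x
  set u := x ⬝ᵥ V⁻¹ *ᵥ x with hu_def
  set Z := x ⬝ᵥ V⁻¹ *ᵥ S with hZ_def
  have key : (V + vecMulVec x x)⁻¹ *ᵥ (S + e • x)
      = V⁻¹ *ᵥ S + ((e - Z) / (1 + u)) • (V⁻¹ *ᵥ x) := by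
    rw [← hV'.inv_mulVec_mulVec (V⁻¹ *ᵥ S + ((e - Z) / (1 + u)) • (V⁻¹ *ᵥ x))]
    congr 1
    rw [add_mulVec, mulVec_add, mulVec_smul, hV.mulVec_inv_mulVec, hV.mulVec_inv_mulVec,
      vecMulVec_mulVec, dotProduct_add, dotProduct_smul, ← hu_def, ← hZ_def]
    ext i
    simp only [Pi.add_apply, Pi.smul_apply, smul_eq_mul, MulOpposite.smul_eq_mul_unop,
      MulOpposite.unop_op]
    field_simp
    ring
  rw [key, add_dotProduct, dotProduct_add, dotProduct_add, smul_dotProduct, dotProduct_smul,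
    smul_dotProduct, dotProduct_smul, ← hu_def, ← hZ_def, hsymm]
  simp only [smul_eq_mul]
  field_simp
  ring

theorem Matrix.PosDef.det_add_vecMulVec {V : Matrix ι ι ℝ} (hV : V.PosDef) (x : ι → ℝ) :
    (V + vecMulVec x x).det = V.det * (1 + x ⬝ᵥ V⁻¹ *ᵥ x) := by
  have h := det_add_replicateCol_mul_replicateRow (ι := Unit)
    ((isUnit_iff_isUnit_det V).1 hV.isUnit) x x
  rw [vecMulVec_eq Unit, h, Matrix.mul_assoc, ← replicateCol_mulVec, det_unique (n := Unit)]
  rfl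

/-- The arithmetic-geometric mean inequality for the eigenvalues. -/
theorem Matrix.PosDef.log_det_le [Nonempty ι] {V : Matrix ι ι ℝ} (hV : V.PosDef) :
    Real.log V.det ≤ Fintype.card ι * Real.log (V.trace / Fintype.card ι) := by
  have hd : (0 : ℝ) < Fintype.card ι := by exact_mod_cast Fintype.card_pos
  have hdet := hV.isHermitian.det_eq_prod_eigenvalues
  have htr := hV.isHermitian.trace_eq_sum_eigenvalues
  simp only [RCLike.ofReal_real_eq_id, id_eq] at hdet htr
  have h := Real.geom_mean_le_arith_mean univ (fun _ : ι => (1 : ℝ)) hV.isHermitian.eigenvalues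
    (fun _ _ => zero_le_one) (by simpa using hd) (fun i _ => (hV.eigenvalues_pos i).le)
  simp only [Real.rpow_one, sum_const, card_univ, nsmul_eq_mul, mul_one, one_mul] at h
  rw [← hdet, ← htr] at h
  have hpos := hV.det_pos
  have := Real.log_le_log (Real.rpow_pos_of_pos hpos _) h
  rw [Real.log_rpow hpos, inv_mul_le_iff₀ hd] at this
  exact this

theorem Matrix.PosDef.dotProduct_inv_mulVec_sub_le {V : Matrix ι ι ℝ} (hV : V.PosDef)
    (a b : ι → ℝ) : (a - b) ⬝ᵥ V⁻¹ *ᵥ (a - b) ≤ 2 * (a ⬝ᵥ V⁻¹ *ᵥ a) + 2 * (b ⬝ᵥ V⁻¹ *ᵥ b) := by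
  have h := hV.dotProduct_inv_mulVec_nonneg (a + b)
  simp only [mulVec_add, dotProduct_add, add_dotProduct, mulVec_sub, dotProduct_sub,
    sub_dotProduct] at h ⊢
  linarith

end LinearAlgebra

section Ridge

variable {d : ℕ}

/-- The regularised Gram matrix of the first `n` features. -/
def ridgeGram (lam : ℝ) (x : ℕ → Fin d → ℝ) (n : ℕ) : Matrix (Fin d) (Fin d) ℝ :=
  lam • (1 : Matrix (Fin d) (Fin d) ℝ) + ∑ s ∈ range n, vecMulVec (x s) (x s)

/-- The sum of the first `n` features weighted by the noise. -/
def weightedSum (x : ℕ → Fin d → ℝ) (e : ℕ → ℝ) (n : ℕ) : Fin d → ℝ :=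
  ∑ s ∈ range n, e s • x s

/-- The squared self-normalized norm of the weighted feature sum. -/
noncomputable def selfNormSq (lam : ℝ) (x : ℕ → Fin d → ℝ) (e : ℕ → ℝ) (n : ℕ) : ℝ :=
  weightedSum x e n ⬝ᵥ (ridgeGram lam x n)⁻¹ *ᵥ weightedSum x e n

/-- The logarithmic volume growth of the regularised Gram matrix. -/
noncomputable def logVolume (lam : ℝ) (x : ℕ → Fin d → ℝ) (n : ℕ) : ℝ :=
  Real.log (ridgeGram lam x n).det - d * Real.log lam

/-- The exponential supermartingale controlling the self-normalized norm. -/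
noncomputable def expPotential (lam B : ℝ) (x : ℕ → Fin d → ℝ) (e : ℕ → ℝ) (n : ℕ) : ℝ :=
  Real.exp (selfNormSq lam x e n / (2 * B ^ 2) - logVolume lam x n / 2)

/-- The predictable coefficient in the linear bound for one step of `expPotential`. -/
noncomputable def stepCoeff (lam B : ℝ) (x : ℕ → Fin d → ℝ) (e : ℕ → ℝ) (n : ℕ) : ℝ :=
  expPotential lam B x e n *
    (Real.exp (-((x n ⬝ᵥ (ridgeGram lam x n)⁻¹ *ᵥ weightedSum x e n) ^ 2 /
        (1 + x n ⬝ᵥ (ridgeGram lam x n)⁻¹ *ᵥ x n) / (2 * B ^ 2))) *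
      Real.sinh ((x n ⬝ᵥ (ridgeGram lam x n)⁻¹ *ᵥ weightedSum x e n) /
        (1 + x n ⬝ᵥ (ridgeGram lam x n)⁻¹ *ᵥ x n) / B) / B)

variable {lam B : ℝ} (x : ℕ → Fin d → ℝ) (e : ℕ → ℝ)

theorem ridgeGram_succ (lam : ℝ) (n : ℕ) :
    ridgeGram lam x (n + 1) = ridgeGram lam x n + vecMulVec (x n) (x n) := by
  rw [ridgeGram, sum_range_succ, ← add_assoc, ridgeGram]

theorem ridgeGram_posDef (hlam : 0 < lam) (n : ℕ) : (ridgeGram lam x n).PosDef :=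
  (PosDef.one.smul hlam).add_posSemidef
    (posSemidef_sum _ fun s _ => posSemidef_vecMulVec_self (x s))

theorem ridgeGram_mulVec (lam : ℝ) (n : ℕ) (w : Fin d → ℝ) :
    ridgeGram lam x n *ᵥ w = lam • w + ∑ s ∈ range n, (x s ⬝ᵥ w) • x s := by
  rw [ridgeGram, add_mulVec, smul_mulVec, one_mulVec, sum_mulVec]
  simp [vecMulVec_mulVec]

theorem trace_ridgeGram_le (lam : ℝ) (n : ℕ) (hx : ∀ s < n, x s ⬝ᵥ x s ≤ 1) :
    (ridgeGram lam x n).trace ≤ lam * d + n := by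
  have h : ∑ s ∈ range n, x s ⬝ᵥ x s ≤ ∑ s ∈ range n, (1 : ℝ) :=
    sum_le_sum fun s hs => hx s (mem_range.1 hs)
  simp only [ridgeGram, trace_add, trace_smul, trace_one, trace_sum, trace_vecMulVec,
    Fintype.card_fin, smul_eq_mul]
  simpa using h

theorem selfNormSq_succ (hlam : 0 < lam) (n : ℕ) :
    selfNormSq lam x e (n + 1) = selfNormSq lam x e n +
      (2 * e n * (x n ⬝ᵥ (ridgeGram lam x n)⁻¹ *ᵥ weightedSum x e n)
        + e n ^ 2 * (x n ⬝ᵥ (ridgeGram lam x n)⁻¹ *ᵥ x n)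
        - (x n ⬝ᵥ (ridgeGram lam x n)⁻¹ *ᵥ weightedSum x e n) ^ 2) /
      (1 + x n ⬝ᵥ (ridgeGram lam x n)⁻¹ *ᵥ x n) := by
  rw [selfNormSq, weightedSum, sum_range_succ, ridgeGram_succ]
  exact (ridgeGram_posDef x hlam n).inv_form_add_vecMulVec _ _ _

theorem logVolume_succ (hlam : 0 < lam) (n : ℕ) :
    logVolume lam x (n + 1) = logVolume lam x n +
      Real.log (1 + x n ⬝ᵥ (ridgeGram lam x n)⁻¹ *ᵥ x n) := by
  have hV := ridgeGram_posDef x hlam n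
  have hu := hV.dotProduct_inv_mulVec_nonneg (x n)
  rw [logVolume, ridgeGram_succ, hV.det_add_vecMulVec, Real.log_mul hV.det_pos.ne' (by positivity),
    logVolume]
  ring

@[simp] theorem logVolume_zero (lam : ℝ) : logVolume lam x 0 = 0 := by
  simp [logVolume, ridgeGram, Real.log_pow]

@[simp] theorem selfNormSq_zero (lam : ℝ) : selfNormSq lam x e 0 = 0 := by
  simp [selfNormSq, weightedSum]

@[simp] theorem expPotential_zero (lam B : ℝ) : expPotential lam B x e 0 = 1 := by
  simp [expPotential]

theorem expPotential_pos (n : ℕ) : 0 < expPotential lam B x e n :=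
  Real.exp_pos _

theorem logVolume_le (hd : 1 ≤ d) (hlam : 0 < lam) (n : ℕ) (hx : ∀ s < n, x s ⬝ᵥ x s ≤ 1) :
    logVolume lam x n ≤ d * Real.log (1 + n / (lam * d)) := by
  have : Nonempty (Fin d) := ⟨⟨0, hd⟩⟩
  have hd' : (0 : ℝ) < d := by exact_mod_cast hd
  have hV := ridgeGram_posDef x hlam n
  have h1 := hV.log_det_le
  have h2 : Real.log ((ridgeGram lam x n).trace / d) ≤ Real.log (lam * (1 + n / (lam * d))) := by
    refine Real.log_le_log (div_pos hV.trace_pos hd') ?_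
    rw [div_le_iff₀ hd']
    refine (trace_ridgeGram_le x lam n hx).trans_eq ?_
    field_simp
  rw [Real.log_mul hlam.ne' (by positivity)] at h2
  rw [Fintype.card_fin] at h1
  have h3 := mul_le_mul_of_nonneg_left h2 hd'.le
  rw [logVolume]
  linarith

theorem div_one_add_le_log {u : ℝ} (hu : 0 ≤ u) : u / (1 + u) ≤ Real.log (1 + u) := by
  have h := Real.one_sub_inv_le_log_of_pos (x := 1 + u) (by positivity)
  convert h using 1
  field_simp
  ring

theorem exp_neg_mul_cosh_le_one {u : ℝ} (hB : B ≠ 0) (hu : 0 ≤ u) (Z : ℝ) :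
    Real.exp (-(Z ^ 2 / (1 + u) / (2 * B ^ 2))) * Real.cosh (Z / (1 + u) / B) ≤ 1 := by
  have h1 := Real.cosh_le_exp_half_sq (Z / (1 + u) / B)
  have h2 : (Z / (1 + u) / B) ^ 2 / 2 ≤ Z ^ 2 / (1 + u) / (2 * B ^ 2) := by
    have : (Z / (1 + u) / B) ^ 2 / 2 = Z ^ 2 / (1 + u) / (2 * B ^ 2) / (1 + u) := by field_simp
    rw [this]
    exact div_le_self (by positivity) (by linarith)
  rw [Real.exp_neg]
  exact inv_mul_le_one_of_le₀ (h1.trans (Real.exp_le_exp.2 h2)) (Real.exp_pos _).le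

theorem selfNormSq_one_le (hlam : 0 < lam) (he : |e 0| ≤ B) :
    selfNormSq lam x e 1 ≤ B ^ 2 * logVolume lam x 1 := by
  have hu := (ridgeGram_posDef x hlam 0).dotProduct_inv_mulVec_nonneg (x 0)
  have h1 := selfNormSq_succ x e hlam 0
  have h2 := logVolume_succ x hlam 0
  have hS : weightedSum x e 0 = 0 := by simp [weightedSum]
  rw [hS] at h1
  simp only [mulVec_zero, dotProduct_zero, selfNormSq_zero, logVolume_zero, zero_add, mul_zero,
    ne_eq, OfNat.ofNat_ne_zero, not_false_eq_true, zero_pow, sub_zero] at h1 h2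
  rw [h1, h2, mul_div_assoc]
  exact mul_le_mul (sq_le_sq' (neg_le_of_abs_le he) (le_of_abs_le he)) (div_one_add_le_log hu)
    (by positivity) (sq_nonneg B)

theorem expPotential_succ_le (hlam : 0 < lam) (hB : 0 < B) (n : ℕ) (he : |e n| ≤ B) :
    expPotential lam B x e (n + 1) ≤ expPotential lam B x e n + stepCoeff lam B x e n * e n := by
  have hu := (ridgeGram_posDef x hlam n).dotProduct_inv_mulVec_nonneg (x n)
  rw [expPotential, selfNormSq_succ x e hlam, logVolume_succ x hlam, stepCoeff]
  set u := x n ⬝ᵥ (ridgeGram lam x n)⁻¹ *ᵥ x n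
  set Z := x n ⬝ᵥ (ridgeGram lam x n)⁻¹ *ᵥ weightedSum x e n
  set M := expPotential lam B x e n with hM
  have hMpos : 0 < M := Real.exp_pos _
  have hu1 : 0 < 1 + u := by positivity
  have hlog := div_one_add_le_log hu
  have hsq : e n ^ 2 ≤ B ^ 2 := sq_le_sq' (neg_le_of_abs_le he) (le_of_abs_le he)
  set a := Z / (1 + u) / B with ha
  set q := Z ^ 2 / (1 + u) / (2 * B ^ 2) with hq
  have ht : |e n / B| ≤ 1 := by rw [abs_div, abs_of_pos hB]; exact (div_le_one hB).2 he
  have hcosh : Real.exp (-q) * Real.cosh a ≤ 1 := exp_neg_mul_cosh_le_one hB.ne' hu Z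
  have hexp : Real.exp (e n / B * a) ≤ Real.cosh a + e n / B * Real.sinh a :=
    Real.exp_mul_le_cosh_add_mul_sinh ht a
  calc _ ≤ M * (Real.exp (-q) * Real.exp (e n / B * a)) := by
        rw [hM, expPotential, ← Real.exp_add, ← Real.exp_add]
        refine Real.exp_le_exp.2 ?_
        have h3 : (2 * e n * Z + e n ^ 2 * u - Z ^ 2) / (1 + u) / (2 * B ^ 2)
            = e n / B * a - q + e n ^ 2 / B ^ 2 * (u / (1 + u)) / 2 := by
          rw [ha, hq]; field_simp; ring
        have h4 : e n ^ 2 / B ^ 2 * (u / (1 + u)) ≤ 1 * Real.log (1 + u) :=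
          mul_le_mul ((div_le_one (by positivity)).2 hsq) hlog (by positivity) zero_le_one
        rw [add_div, h3]
        linarith
    _ ≤ M * (Real.exp (-q) * (Real.cosh a + e n / B * Real.sinh a)) := by gcongr
    _ = M * (Real.exp (-q) * Real.cosh a) + M * (Real.exp (-q) * Real.sinh a / B) * e n := by
        ring
    _ ≤ _ := by
        gcongr
        exact mul_le_of_le_one_right hMpos.le hcosh

theorem abs_stepCoeff_le (hlam : 0 < lam) (hB : 0 < B) (n : ℕ) :
    |stepCoeff lam B x e n| ≤ expPotential lam B x e n / B := by
  have hu := (ridgeGram_posDef x hlam n).dotProduct_inv_mulVec_nonneg (x n)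
  rw [stepCoeff]
  set u := x n ⬝ᵥ (ridgeGram lam x n)⁻¹ *ᵥ x n
  set Z := x n ⬝ᵥ (ridgeGram lam x n)⁻¹ *ᵥ weightedSum x e n
  set M := expPotential lam B x e n with hM
  have hMpos : 0 < M := Real.exp_pos _
  have hu1 : 0 < 1 + u := by positivity
  set a := Z / (1 + u) / B with ha
  set q := Z ^ 2 / (1 + u) / (2 * B ^ 2) with hq
  have hcosh : Real.exp (-q) * Real.cosh a ≤ 1 := exp_neg_mul_cosh_le_one hB.ne' hu Z
  have hsinh : |Real.sinh a| ≤ Real.cosh a := by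
    rw [abs_le]
    constructor
    · have := Real.sinh_lt_cosh (-a)
      rw [Real.sinh_neg, Real.cosh_neg] at this
      linarith
    · exact (Real.sinh_lt_cosh _).le
  rw [abs_mul, abs_div, abs_mul, abs_of_pos hMpos, abs_of_pos hB, abs_of_pos (Real.exp_pos _),
    ← mul_div_assoc]
  gcongr
  refine mul_le_of_le_one_right hMpos.le (le_trans ?_ hcosh)
  gcongr

end Ridge

section Measurability

variable {Ω ι : Type*} {m : MeasurableSpace Ω} [Fintype ι]

theorem measurable_dotProduct_const {x : Ω → ι → ℝ} (hx : Measurable x) (w : ι → ℝ) :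
    Measurable fun ω => x ω ⬝ᵥ w :=
  Finset.measurable_fun_sum _ fun i _ => (measurable_pi_iff.1 hx i).mul_const _

variable [DecidableEq ι]

theorem measurable_matrix_det {V : Ω → Matrix ι ι ℝ} (hV : ∀ i j, Measurable fun ω => V ω i j) :
    Measurable fun ω => (V ω).det := by
  simp only [det_apply']
  exact Finset.measurable_fun_sum _ fun σ _ =>
    (Finset.measurable_fun_prod _ fun i _ => hV _ _).const_mul _

theorem measurable_matrix_inv_apply {V : Ω → Matrix ι ι ℝ}
    (hV : ∀ i j, Measurable fun ω => V ω i j) (i j : ι) :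
    Measurable fun ω => (V ω)⁻¹ i j := by
  simp only [Matrix.inv_def, Matrix.smul_apply, smul_eq_mul, Ring.inverse_eq_inv', adjugate_apply]
  refine (measurable_matrix_det hV).inv.mul (measurable_matrix_det fun k l => ?_)
  by_cases hk : k = j
  · subst hk
    simp
  · simpa [updateRow_ne hk] using hV k l

theorem measurable_inv_form {V : Ω → Matrix ι ι ℝ} {a b : Ω → ι → ℝ}
    (hV : ∀ i j, Measurable fun ω => V ω i j) (ha : Measurable a) (hb : Measurable b) :
    Measurable fun ω => a ω ⬝ᵥ (V ω)⁻¹ *ᵥ b ω := by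
  simp only [dotProduct, mulVec]
  exact Finset.measurable_fun_sum _ fun i _ => (measurable_pi_iff.1 ha i).mul <|
    Finset.measurable_fun_sum _ fun j _ =>
      (measurable_matrix_inv_apply hV i j).mul (measurable_pi_iff.1 hb j)

variable {d : ℕ} {φ : ℕ → Ω → Fin d → ℝ} {η : ℕ → Ω → ℝ} {n : ℕ}

theorem measurable_ridgeGram_apply (lam : ℝ) (hφ : ∀ s < n, Measurable (φ s)) (i j : Fin d) :
    Measurable fun ω => ridgeGram lam (φ · ω) n i j := by
  simp only [ridgeGram, Matrix.add_apply, Matrix.sum_apply, vecMulVec_apply]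
  exact (Finset.measurable_fun_sum _ fun s hs =>
    (measurable_pi_iff.1 (hφ s (mem_range.1 hs)) i).mul
      (measurable_pi_iff.1 (hφ s (mem_range.1 hs)) j)).const_add _

theorem measurable_weightedSum (hφ : ∀ s < n, Measurable (φ s)) (hη : ∀ s < n, Measurable (η s)) :
    Measurable fun ω => weightedSum (φ · ω) (η · ω) n :=
  Finset.measurable_fun_sum _ fun s hs =>
    (hη s (mem_range.1 hs)).smul (hφ s (mem_range.1 hs))

theorem measurable_expPotential (lam B : ℝ) (hφ : ∀ s < n, Measurable (φ s))
    (hη : ∀ s < n, Measurable (η s)) :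
    Measurable fun ω => expPotential lam B (φ · ω) (η · ω) n := by
  have hV := measurable_ridgeGram_apply lam hφ
  have hS := measurable_weightedSum hφ hη
  have h1 := measurable_inv_form hV hS hS
  have h2 := (measurable_matrix_det hV).log.sub_const (d * Real.log lam)
  exact ((h1.div_const _).sub (h2.div_const _)).exp

theorem measurable_stepCoeff (lam B : ℝ) (hφ : ∀ s < n + 1, Measurable (φ s))
    (hη : ∀ s < n, Measurable (η s)) :
    Measurable fun ω => stepCoeff lam B (φ · ω) (η · ω) n := by
  have hφ' : ∀ s < n, Measurable (φ s) := fun s hs => hφ s (hs.trans n.lt_succ_self)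
  have hV := measurable_ridgeGram_apply lam hφ'
  have hS := measurable_weightedSum hφ' hη
  have hx := hφ n n.lt_succ_self
  have hu := (measurable_inv_form hV hx hx).const_add 1
  have hZ := measurable_inv_form hV hx hS
  refine (measurable_expPotential lam B hφ' hη).mul (Measurable.div_const (Measurable.mul ?_ ?_) _)
  · exact (((hZ.pow_const 2).div hu).div_const _).neg.exp
  · exact ((hZ.div hu).div_const _).sinh

end Measurability

section Probability

variable {Ω : Type*} {m0 : MeasurableSpace Ω} {P : Measure Ω}

theorem integral_mul_eq_zero_of_condExp_eq_zero [IsProbabilityMeasure P] {m : MeasurableSpace Ω}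
    (hm : m ≤ m0)
    {K e : Ω → ℝ} (hK : StronglyMeasurable[m] K) (hKe : Integrable (K * e) P)
    (he : Integrable e P) (hcond : P[e|m] =ᵐ[P] 0) : ∫ ω, K ω * e ω ∂P = 0 := by
  have h := condExp_mul_of_stronglyMeasurable_left hK hKe he
  change ∫ ω, (K * e) ω ∂P = 0
  rw [← integral_condExp hm]
  refine integral_eq_zero_of_ae ?_
  filter_upwards [h, hcond] with ω h1 h2
  simp [h1, h2]

variable {ℱ : Filtration ℕ m0} {d N : ℕ} {lam B : ℝ} {φ : ℕ → Ω → Fin d → ℝ} {η : ℕ → Ω → ℝ}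

theorem integrable_integral_expPotential_le_one [IsProbabilityMeasure P] (hlam : 0 < lam) (hB : 0 < B)
    (hφ : ∀ t < N, Measurable[ℱ (t + 1)] (φ t)) (hη : ∀ t < N, Measurable[ℱ (t + 2)] (η t))
    (hbdd : ∀ t < N, ∀ᵐ ω ∂P, |η t ω| ≤ B) (hcond : ∀ t < N, P[η t|ℱ (t + 1)] =ᵐ[P] 0)
    (n : ℕ) (hn : n ≤ N) :
    Integrable (fun ω => expPotential lam B (φ · ω) (η · ω) n) P ∧
      ∫ ω, expPotential lam B (φ · ω) (η · ω) n ∂P ≤ 1 := by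
  induction n with
  | zero => simp
  | succ n ih =>
    obtain ⟨hint, hle⟩ := ih (by omega)
    have hnN : n < N := by omega
    have hφm : ∀ s < n + 1, Measurable[ℱ (n + 1)] (φ s) := fun s hs =>
      (hφ s (by omega)).mono (ℱ.mono (by omega)) le_rfl
    have hηm : ∀ s < n, Measurable[ℱ (n + 1)] (η s) := fun s hs =>
      (hη s (by omega)).mono (ℱ.mono (by omega)) le_rfl
    have hη0 : ∀ s < n + 1, Measurable (η s) := fun s hs =>
      (hη s (by omega)).mono (ℱ.le _) le_rfl
    have hK := measurable_stepCoeff lam B hφm hηm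
    have hK0 := (hK.mono (ℱ.le _) le_rfl).aestronglyMeasurable (μ := P)
    have hηn := (hη0 n n.lt_succ_self).aestronglyMeasurable (μ := P)
    have hKint : Integrable (fun ω => stepCoeff lam B (φ · ω) (η · ω) n) P :=
      (hint.div_const B).mono' hK0 (ae_of_all _ fun ω => abs_stepCoeff_le _ _ hlam hB n)
    have hKη : Integrable (fun ω => stepCoeff lam B (φ · ω) (η · ω) n * η n ω) P :=
      hKint.mul_bdd (c := B) hηn (hbdd n hnN)
    have hηint : Integrable (η n) P := .of_bound hηn B (hbdd n hnN)
    have hzero := integral_mul_eq_zero_of_condExp_eq_zero (ℱ.le _) hK.stronglyMeasurable hKη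
      hηint (hcond n hnN)
    have hstep : ∀ᵐ ω ∂P, expPotential lam B (φ · ω) (η · ω) (n + 1) ≤
        expPotential lam B (φ · ω) (η · ω) n + stepCoeff lam B (φ · ω) (η · ω) n * η n ω := by
      filter_upwards [hbdd n hnN] with ω hω
      exact expPotential_succ_le (φ · ω) (η · ω) hlam hB n hω
    have hint' : Integrable (fun ω => expPotential lam B (φ · ω) (η · ω) (n + 1)) P := by
      refine (hint.add hKη).mono' (measurable_expPotential lam B
        (fun s hs => (hφm s hs).mono (ℱ.le _) le_rfl) hη0).aestronglyMeasurable ?_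
      filter_upwards [hstep] with ω hω
      rwa [Real.norm_of_nonneg (expPotential_pos _ _ _).le]
    refine ⟨hint', (integral_mono_ae hint' (hint.add hKη) hstep).trans ?_⟩
    have := integral_add hint hKη
    simp only [Pi.add_apply]
    linarith

theorem measureReal_exists_expPotential_ge_le {δ : ℝ} (hδ : 0 < δ) (hN : 1 ≤ N)
    (h : ∀ n ≤ N, Integrable (fun ω => expPotential lam B (φ · ω) (η · ω) n) P ∧
      ∫ ω, expPotential lam B (φ · ω) (η · ω) n ∂P ≤ 1) :
    P.real (⋃ n ∈ Ioc 1 N, {ω | (n : ℝ) ^ 2 / δ ≤ expPotential lam B (φ · ω) (η · ω) n}) ≤ δ := by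
  have hmarkov : ∀ n ∈ Ioc 1 N,
      P.real {ω | (n : ℝ) ^ 2 / δ ≤ expPotential lam B (φ · ω) (η · ω) n} ≤
        δ * ((n : ℝ) ^ 2)⁻¹ := by
    intro n hn
    obtain ⟨hn1, hnN⟩ := mem_Ioc.1 hn
    have hn0 : (0 : ℝ) < n := by exact_mod_cast (by omega : 0 < n)
    obtain ⟨hint, hle⟩ := h n hnN
    have hm := (mul_meas_ge_le_integral_of_nonneg
      (ae_of_all _ fun ω => (expPotential_pos (φ · ω) (η · ω) n).le) hint ((n : ℝ) ^ 2 / δ)).trans hle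
    rw [← div_eq_mul_inv, le_div_iff₀ (by positivity)]
    rw [div_mul_eq_mul_div, div_le_one hδ] at hm
    linarith
  calc _ ≤ ∑ n ∈ Ioc 1 N, δ * ((n : ℝ) ^ 2)⁻¹ :=
        (measureReal_biUnion_finset_le _ _).trans (sum_le_sum hmarkov)
    _ ≤ δ * 1 := by
        rw [← mul_sum]
        gcongr
        have := sum_Ioc_inv_sq_le_sub (α := ℝ) one_ne_zero hN
        have h0 : (0 : ℝ) ≤ (N : ℝ)⁻¹ := by positivity
        simp only [Nat.cast_one, inv_one] at this
        linarith
    _ = δ := mul_one δ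

end Probability

section Ridge

variable {d : ℕ} {lam B : ℝ} (x : ℕ → Fin d → ℝ) (e : ℕ → ℝ)

theorem selfNormSq_lt_of_expPotential_lt (hB : 0 < B) {n : ℕ} {r : ℝ}
    (h : expPotential lam B x e n < r) :
    selfNormSq lam x e n < B ^ 2 * (logVolume lam x n + 2 * Real.log r) := by
  have h1 := (Real.lt_log_iff_exp_lt ((Real.exp_pos _).trans h)).2 h
  rw [sub_lt_iff_lt_add, div_lt_iff₀ (by positivity)] at h1
  linarith

theorem sq_mul_inv_form_le {V : Matrix (Fin d) (Fin d) ℝ} (hV : V.PosDef) (hlam : 0 < lam)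
    (hlow : ∀ p : Fin d → ℝ, lam * (p ⬝ᵥ p) ≤ p ⬝ᵥ V *ᵥ p) (w : Fin d → ℝ) :
    lam ^ 2 * (w ⬝ᵥ V⁻¹ *ᵥ w) ≤ lam * (w ⬝ᵥ w) := by
  have h1 := hlow (V⁻¹ *ᵥ w)
  rw [hV.mulVec_inv_mulVec, dotProduct_comm (V⁻¹ *ᵥ w) w] at h1
  set p := V⁻¹ *ᵥ w
  have h2 : 0 ≤ (w - lam • p) ⬝ᵥ (w - lam • p) := by
    simpa using dotProduct_star_self_nonneg (w - lam • p)
  simp only [dotProduct_sub, sub_dotProduct, dotProduct_smul, smul_dotProduct, smul_eq_mul,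
    dotProduct_comm p w] at h2
  nlinarith

theorem ridgeGram_lower_bound (lam : ℝ) (n : ℕ) (p : Fin d → ℝ) :
    lam * (p ⬝ᵥ p) ≤ p ⬝ᵥ ridgeGram lam x n *ᵥ p := by
  rw [ridgeGram_mulVec, dotProduct_add, dotProduct_smul, smul_eq_mul, dotProduct_sum]
  refine le_add_of_nonneg_right (sum_nonneg fun s _ => ?_)
  rw [dotProduct_smul, dotProduct_comm, smul_eq_mul]
  exact mul_self_nonneg _

/-- The ridge estimation error splits into a noise part and a regularisation part. -/
theorem ridge_error_le (hlam : 0 < lam) (w : Fin d → ℝ) (z : ℕ → ℝ) (n : ℕ) :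
    ((ridgeGram lam x n)⁻¹ *ᵥ (∑ s ∈ range n, z s • x s) - w) ⬝ᵥ ridgeGram lam x n *ᵥ
        ((ridgeGram lam x n)⁻¹ *ᵥ (∑ s ∈ range n, z s • x s) - w) ≤
      2 * selfNormSq lam x (fun s => z s - x s ⬝ᵥ w) n + 2 * lam * (w ⬝ᵥ w) := by
  have hV := ridgeGram_posDef x hlam n
  have hS : ridgeGram lam x n *ᵥ ((ridgeGram lam x n)⁻¹ *ᵥ (∑ s ∈ range n, z s • x s) - w) =
      weightedSum x (fun s => z s - x s ⬝ᵥ w) n - lam • w := by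
    rw [mulVec_sub, hV.mulVec_inv_mulVec, ridgeGram_mulVec, weightedSum]
    simp only [sub_smul, sum_sub_distrib]
    abel
  have hS' : (ridgeGram lam x n)⁻¹ *ᵥ (∑ s ∈ range n, z s • x s) - w =
      (ridgeGram lam x n)⁻¹ *ᵥ (weightedSum x (fun s => z s - x s ⬝ᵥ w) n - lam • w) := by
    rw [← hS, hV.inv_mulVec_mulVec]
  rw [hS, hS', dotProduct_comm]
  have h1 := hV.dotProduct_inv_mulVec_sub_le (weightedSum x (fun s => z s - x s ⬝ᵥ w) n) (lam • w)
  have h2 := sq_mul_inv_form_le hV hlam (ridgeGram_lower_bound x lam n) w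
  rw [mulVec_smul, dotProduct_smul, smul_dotProduct, smul_eq_mul, smul_eq_mul] at h1
  refine h1.trans ?_
  rw [selfNormSq]
  linarith

theorem sqrt_le_of_le_add {Θ Q W D l L : ℝ} (hlam : 0 < lam) (hB : 0 < B) (hW : 0 ≤ W)
    (hD : 0 ≤ D) (hL : 1 / 4 ≤ L) (hl : 4 * l ≤ 16 / 9 * L ^ 2) (hΘ : Θ ≤ 2 * Q + 2 * lam * W)
    (hQ : Q ≤ B ^ 2 * (D + 2 * l)) :
    √Θ ≤ √(2 * lam) * √W + 2 * √2 * B * √(D * L) + 4 / 3 * B * L := by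
  have hL0 : 0 ≤ L := by linarith
  have h1 : (√(2 * lam) * √W) ^ 2 = 2 * lam * W := by
    rw [mul_pow, Real.sq_sqrt (by positivity), Real.sq_sqrt hW]
  have h2 : (2 * √2 * B * √(D * L)) ^ 2 = 8 * (B ^ 2 * (D * L)) := by
    rw [mul_pow, Real.sq_sqrt (by positivity), mul_pow, mul_pow, Real.sq_sqrt zero_le_two]
    ring
  have h3 : B ^ 2 * D ≤ 4 * (B ^ 2 * (D * L)) := by
    have : D ≤ 4 * (D * L) := by nlinarith
    nlinarith [sq_nonneg B]
  have h4 : B ^ 2 * (4 * l) ≤ B ^ 2 * (16 / 9 * L ^ 2) := by gcongr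
  have hA : 0 ≤ √(2 * lam) * √W := by positivity
  have hC : 0 ≤ 2 * √2 * B * √(D * L) := by positivity
  have hE : 0 ≤ 4 / 3 * B * L := by positivity
  set A := √(2 * lam) * √W
  set C := 2 * √2 * B * √(D * L)
  refine Real.sqrt_le_iff.2 ⟨by positivity, ?_⟩
  nlinarith [mul_nonneg hA hC, mul_nonneg hA hE, mul_nonneg hC hE]

end Ridge

theorem four_mul_log_le {r : ℝ} (hr : 0 < r) :
    4 * Real.log r ≤ 16 / 9 * Real.log (2 * r) ^ 2 := by
  rw [Real.log_mul two_ne_zero hr.ne']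
  have h2 := Real.log_two_gt_d9
  nlinarith [sq_nonneg (Real.log r - Real.log 2), sq_nonneg (Real.log r + Real.log 2 - 9 / 8)]

/-- **Self-normalized uniform-in-time concentration for online ridge regression** with
adapted features and bounded responses.  (Indices `t = 0, …, N−1` play the role of the
paper's `t = 1, …, N`: `φ t` is `𝓕_{t+1}`-measurable and `y t` is `𝓕_{t+2}`-measurable
with `E[y t | 𝓕_{t+1}] = φ tᵀ w`.) -/
theorem online_ridge_concentration {Ω : Type*} [m0 : MeasurableSpace Ω]
    (P : Measure Ω) [IsProbabilityMeasure P] (ℱ : Filtration ℕ m0)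
    (d N : ℕ) (hd : 1 ≤ d) (hN : 1 ≤ N)
    (lam B δ : ℝ) (hlam : 0 < lam) (hB : 0 < B) (hδ : δ ∈ Set.Ioo (0 : ℝ) 1)
    (w : Fin d → ℝ)
    (φ : ℕ → Ω → Fin d → ℝ) (y : ℕ → Ω → ℝ)
    (hφmeas : ∀ t < N, Measurable[ℱ (t + 1)] (φ t))
    (hφnorm : ∀ t < N, ∀ᵐ ω ∂P, Real.sqrt (φ t ω ⬝ᵥ φ t ω) ≤ 1)
    (hymeas : ∀ t < N, Measurable[ℱ (t + 2)] (y t))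
    (hybdd : ∀ t < N, ∀ᵐ ω ∂P, 0 ≤ y t ω ∧ y t ω ≤ B)
    (hcond : ∀ t < N, P[y t|ℱ (t + 1)] =ᵐ[P] fun ω => φ t ω ⬝ᵥ w)
    (Shat : ℕ → Ω → Matrix (Fin d) (Fin d) ℝ)
    (hShat : ∀ t ω, Shat t ω = lam • (1 : Matrix (Fin d) (Fin d) ℝ)
        + ∑ s ∈ Finset.range t, vecMulVec (φ s ω) (φ s ω))
    (What : ℕ → Ω → Fin d → ℝ)
    (hWhat : ∀ t ω, What t ω = (Shat t ω)⁻¹ *ᵥ ∑ s ∈ Finset.range t, y s ω • φ s ω)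
    (Θ : ℕ → Ω → ℝ)
    (hΘ : ∀ t ω, Θ t ω = (What t ω - w) ⬝ᵥ Shat t ω *ᵥ (What t ω - w)) :
    ENNReal.ofReal (1 - δ) ≤
      P {ω | ∀ n, 1 ≤ n → n ≤ N →
        Real.sqrt (Θ n ω)
          ≤ Real.sqrt (2 * lam) * Real.sqrt (w ⬝ᵥ w)
            + 2 * Real.sqrt 2 * B
              * Real.sqrt (d * Real.log (1 + n / (lam * d)) * Real.log (2 * n ^ 2 / δ))
            + (4 / 3) * B * Real.log (2 * n ^ 2 / δ)} := by
  obtain ⟨hδ0, hδ1⟩ := hδ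
  have hd0 : (0 : ℝ) < d := by exact_mod_cast hd
  set η : ℕ → Ω → ℝ := fun t ω => y t ω - φ t ω ⬝ᵥ w
  have hdot : ∀ t < N, Measurable[ℱ (t + 1)] fun ω => φ t ω ⬝ᵥ w := fun t ht =>
    measurable_dotProduct_const (hφmeas t ht) w
  have hηmeas : ∀ t < N, Measurable[ℱ (t + 2)] (η t) := fun t ht =>
    (hymeas t ht).sub ((hdot t ht).mono (ℱ.mono (by omega)) le_rfl)
  have hyint : ∀ t < N, Integrable (y t) P := fun t ht => by
    refine .of_bound ((hymeas t ht).mono (ℱ.le _) le_rfl).aestronglyMeasurable B ?_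
    filter_upwards [hybdd t ht] with ω hω
    rw [Real.norm_of_nonneg hω.1]
    exact hω.2
  have hdint : ∀ t < N, Integrable (fun ω => φ t ω ⬝ᵥ w) P := fun t ht =>
    integrable_condExp.congr (hcond t ht)
  have hηbdd : ∀ t < N, ∀ᵐ ω ∂P, |η t ω| ≤ B := by
    intro t ht
    have h0 : 0 ≤ᵐ[P] P[y t|ℱ (t + 1)] :=
      condExp_nonneg ((hybdd t ht).mono fun ω hω => hω.1)
    have h1 : P[y t|ℱ (t + 1)] ≤ᵐ[P] P[fun _ => B|ℱ (t + 1)] :=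
      condExp_mono (hyint t ht) (integrable_const B) ((hybdd t ht).mono fun ω hω => hω.2)
    rw [condExp_const (ℱ.le _)] at h1
    filter_upwards [hybdd t ht, hcond t ht, h0, h1] with ω hy hc hc0 hc1
    rw [hc] at hc0 hc1
    simp only [Pi.zero_apply] at hc0
    exact abs_le.2 ⟨by linarith [hy.1], by linarith [hy.2]⟩
  have hηcond : ∀ t < N, P[η t|ℱ (t + 1)] =ᵐ[P] 0 := by
    intro t ht
    have h1 := condExp_sub (hyint t ht) (hdint t ht) (ℱ (t + 1))
    rw [condExp_of_stronglyMeasurable (ℱ.le _) (hdot t ht).stronglyMeasurable (hdint t ht)] at h1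
    filter_upwards [h1, hcond t ht] with ω h1 h2
    refine h1.trans ?_
    simp [h2]
  have hbad := measureReal_exists_expPotential_ge_le hδ0 hN
    (integrable_integral_expPotential_le_one hlam hB hφmeas hηmeas hηbdd hηcond)
  set bad := ⋃ n ∈ Ioc 1 N, {ω | (n : ℝ) ^ 2 / δ ≤ expPotential lam B (φ · ω) (η · ω) n}
  have hae : ∀ᵐ ω ∂P, ∀ t < N, √(φ t ω ⬝ᵥ φ t ω) ≤ 1 ∧ |η t ω| ≤ B :=
    ae_all_iff.2 fun t => by
      by_cases ht : t < N
      · filter_upwards [hφnorm t ht, hηbdd t ht] with ω h1 h2 _ using ⟨h1, h2⟩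
      · exact ae_of_all _ fun ω h => absurd h ht
  have hcompl : ENNReal.ofReal (1 - δ) ≤ P badᶜ := by
    have h1 : (1 : ENNReal) ≤ P bad + P badᶜ := by
      rw [← measure_univ (μ := P), ← Set.union_compl_self bad]
      exact measure_union_le _ _
    rw [ENNReal.ofReal_sub _ hδ0.le, ENNReal.ofReal_one, tsub_le_iff_left]
    refine h1.trans (add_le_add ?_ le_rfl)
    rw [← ofReal_measureReal (measure_ne_top P bad)]
    exact ENNReal.ofReal_le_ofReal hbad
  refine hcompl.trans (measure_mono_ae ?_)
  filter_upwards [hae] with ω hω hωbad n hn1 hnN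
  have hgram : Shat n ω = ridgeGram lam (φ · ω) n := hShat n ω
  have hΘle : Θ n ω ≤ 2 * selfNormSq lam (φ · ω) (η · ω) n + 2 * lam * (w ⬝ᵥ w) := by
    rw [hΘ, hWhat, hgram]
    exact ridge_error_le (φ · ω) hlam w (y · ω) n
  have hvol := logVolume_le (φ · ω) hd hlam n fun s hs =>
    Real.sqrt_le_one.1 (hω s (by omega)).1
  have hD : 0 ≤ d * Real.log (1 + n / (lam * d)) :=
    mul_nonneg hd0.le (Real.log_nonneg (le_add_of_nonneg_right (by positivity)))
  have hn : (1 : ℝ) ≤ n := by exact_mod_cast hn1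
  have hr : 1 ≤ (n : ℝ) ^ 2 / δ := by
    rw [one_le_div hδ0]
    exact hδ1.le.trans (one_le_pow₀ hn)
  have hL : 1 / 4 ≤ Real.log (2 * n ^ 2 / δ) := by
    have h1 : Real.log 2 ≤ Real.log (2 * n ^ 2 / δ) :=
      Real.log_le_log two_pos (by rw [mul_div_assoc]; linarith)
    linarith [Real.log_two_gt_d9]
  have hW : 0 ≤ w ⬝ᵥ w := by simpa using dotProduct_star_self_nonneg w
  rcases hn1.eq_or_lt with rfl | hn2
  · refine sqrt_le_of_le_add (l := 0) hlam hB hW hD hL (by rw [mul_zero]; positivity) hΘle ?_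
    refine (selfNormSq_one_le (φ · ω) (η · ω) hlam (hω 0 (by omega)).2).trans ?_
    rw [mul_zero, add_zero]
    gcongr
  · refine sqrt_le_of_le_add (l := Real.log (n ^ 2 / δ)) hlam hB hW hD hL ?_ hΘle ?_
    · rw [mul_div_assoc]
      exact four_mul_log_le (by positivity)
    · have hlt : expPotential lam B (φ · ω) (η · ω) n < (n : ℝ) ^ 2 / δ := by
        by_contra! h
        exact hωbad (Set.mem_biUnion (mem_coe.2 (mem_Ioc.2 ⟨hn2, hnN⟩)) h)
      refine (selfNormSq_lt_of_expPotential_lt (φ · ω) (η · ω) hB hlt).le.trans ?_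
      gcongr
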